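/- Let G = (V, E) be a connected finite simple graph and let {A_1, …, A_m} be a partition of V into m ≥ 2 nonempty disjoint subsets. Then there exists a set S with ∅ ≠ S ⊊ {1, …, m} such that, setting A = ∪_{t ∈ S} A_t, the number of edges of G with exactly one endpoint in A is at least m − 1. -/

import Mathlib

open Finset

/-- The number of edges of `G` crossing the bipartition `{A, V \ A}` (each such edge is
counted once, as the ordered pair whose first component lies in `A`). -/
def crossCount {W : Type} [Fintype W] [DecidableEq W] (G : SimpleGraph W)
    [DecidableRel G.Adj] (A : Finset W) : ℕ :=
  ((univ ×ˢ univ).filter fun p : W × W => G.Adj p.1 p.2 ∧ p.1 ∈ A ∧ p.2 ∉ A).card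

/-- The quotient of `G` by a map `f` on its vertices, restricted to the edges that join a class
in `S` to a class outside `S`. -/
def cutQuotient {V ι : Type*} (G : SimpleGraph V) (f : V → ι) (S : Finset ι) :
    SimpleGraph ι where
  Adj s t := ¬(s ∈ S ↔ t ∈ S) ∧ ∃ u v, G.Adj u v ∧ f u = s ∧ f v = t
  symm := ⟨fun _ _ ⟨h, u, v, huv, hu, hv⟩ => ⟨fun h' => h h'.symm, v, u, huv.symm, hv, hu⟩⟩
  loopless := ⟨fun _ h => h.1 Iff.rfl⟩

/-- For a suitable choice of `S`, namely a maximum cut, the bipartite quotient graph of the cut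
is connected. -/
theorem exists_cutQuotient_connected {V ι : Type*} [Fintype V] [Fintype ι] (G : SimpleGraph V)
    (hconn : G.Connected) (f : V → ι) (hf : Function.Surjective f) :
    ∃ S : Finset ι, (cutQuotient G f S).Connected := by
  classical
  let D : Finset ι → Finset (V × V) := fun S =>
    univ.filter fun p => G.Adj p.1 p.2 ∧ ¬(f p.1 ∈ S ↔ f p.2 ∈ S)
  obtain ⟨S, -, hS⟩ := exists_max_image (univ : Finset (Finset ι)) (fun S => (D S).card)
    univ_nonempty
  refine ⟨S, ?_⟩
  have : Nonempty ι := hconn.nonempty.map f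
  refine SimpleGraph.Connected.mk fun a b => ?_
  by_contra hab
  let T : Finset ι := univ.filter fun t => (cutQuotient G f S).Reachable a t
  have hT : ∀ t, t ∈ T ↔ (cutQuotient G f S).Reachable a t := by simp [T]
  have hclosed : ∀ u v, G.Adj u v → ¬(f u ∈ S ↔ f v ∈ S) → (f u ∈ T ↔ f v ∈ T) := by
    intro u v huv hcut
    have hadj : (cutQuotient G f S).Adj (f u) (f v) := ⟨hcut, u, v, huv, rfl, rfl⟩
    rw [hT, hT]
    exact ⟨fun h => h.trans hadj.reachable, fun h => h.trans hadj.symm.reachable⟩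
  obtain ⟨x, rfl⟩ := hf a
  obtain ⟨y, rfl⟩ := hf b
  obtain ⟨w⟩ := hconn.preconnected x y
  obtain ⟨d, -, hd₁, hd₂⟩ := w.exists_boundary_dart {v | f v ∈ T}
    ((hT _).2 (SimpleGraph.Reachable.refl _)) (fun h => hab ((hT _).1 h))
  have hd := d.adj
  simp only [Set.mem_ofPred_eq] at hd₁ hd₂
  have hlt : D S ⊂ D (symmDiff S T) := by
    refine (ssubset_iff_of_subset ?_).2 ⟨(d.fst, d.snd), ?_, ?_⟩
    · intro p hp
      simp only [D, mem_filter, mem_univ, true_and, mem_symmDiff] at hp ⊢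
      have := hclosed _ _ hp.1 hp.2
      tauto
    all_goals
      have := hclosed _ _ hd
      simp only [D, mem_filter, mem_univ, true_and, mem_symmDiff]
      tauto
  exact (card_lt_card hlt).not_ge (hS _ (mem_univ _))

/-- For a connected graph `G` and a partition of its vertex set into `m ≥ 2` nonempty
disjoint subsets `A 0, …, A (m-1)`, there is a set `S` with `∅ ≠ S ⊊ Fin m` such that at
least `m - 1` edges of `G` have exactly one endpoint in `⋃_{t ∈ S} A t`. -/
theorem exists_union_crossCount_ge {V : Type} [Fintype V] [DecidableEq V]
    (G : SimpleGraph V) [DecidableRel G.Adj] (hconn : G.Connected)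
    {m : ℕ} (hm : 2 ≤ m) (A : Fin m → Finset V)
    (hne : ∀ t, (A t).Nonempty)
    (hdisj : ∀ t t', t ≠ t' → Disjoint (A t) (A t'))
    (hcover : univ.biUnion A = univ) :
    ∃ S : Finset (Fin m), S.Nonempty ∧ S ≠ univ ∧
      m - 1 ≤ crossCount G (S.biUnion A) := by
  classical
  have hex : ∀ v, ∃ t, v ∈ A t := fun v => by
    simpa using (Finset.ext_iff.1 hcover v).2 (mem_univ v)
  choose f hf using hex
  have hmem : ∀ v t, v ∈ A t ↔ f v = t := fun v t =>
    ⟨fun h => by_contra fun hn => disjoint_left.1 (hdisj _ _ hn) (hf v) h, fun h => h ▸ hf v⟩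
  have hunion : ∀ (S : Finset (Fin m)) v, v ∈ S.biUnion A ↔ f v ∈ S := by
    simp [hmem]
  have hsurj : Function.Surjective f := fun t => (hne t).imp fun v hv => (hmem v t).1 hv
  obtain ⟨S, hS⟩ := exists_cutQuotient_connected G hconn f hsurj
  have hcard : m - 1 ≤ crossCount G (S.biUnion A) := by
    have hedges := hS.card_vert_le_card_edgeSet_add_one
    rw [Nat.card_eq_fintype_card, Fintype.card_fin, Nat.card_eq_fintype_card,
      ← SimpleGraph.edgeFinset_card] at hedges
    have hsub : (cutQuotient G f S).edgeFinset.card ≤ crossCount G (S.biUnion A) := by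
      refine (card_le_card ?_).trans
        (card_image_le (f := fun p : V × V => s(f p.1, f p.2)))
      intro e he
      induction e with | _ s t
      obtain ⟨hst, u, v, huv, rfl, rfl⟩ := SimpleGraph.mem_edgeFinset.1 he
      simp only [mem_image, mem_filter, mem_product, mem_univ, true_and, hunion]
      by_cases hu : f u ∈ S
      · exact ⟨(u, v), ⟨huv, hu, by tauto⟩, rfl⟩
      · exact ⟨(v, u), ⟨huv.symm, by tauto, hu⟩, Sym2.eq_swap⟩
    omega
  have hpos : 0 < crossCount G (S.biUnion A) := by omega
  obtain ⟨p, hp⟩ := card_pos.1 hpos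
  simp only [mem_filter, mem_product, mem_univ, true_and, hunion] at hp
  exact ⟨S, ⟨_, hp.2.1⟩, fun h => hp.2.2 (h ▸ mem_univ _), hcard⟩
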